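/- Let p ≥ 1, let G be an α-critical finite simple graph on n vertices with G ∈ W_p, and let r = α(G) ≥ 2. If n < p(3r−1)(r−1)/(3r−4), then G is the disjoint union of r complete graphs, each of order at least p. -/

import Mathlib

open Finset
open scoped Classical

/-- `S` is an independent set of the graph `G`. -/
def IsIndep {V : Type*} (G : SimpleGraph V) (S : Finset V) : Prop :=
  ∀ ⦃x⦄, x ∈ S → ∀ ⦃y⦄, y ∈ S → x ≠ y → ¬ G.Adj x y

/-- The independence number `α(G)` of a finite graph `G`. -/
noncomputable def alpha {V : Type*} [Fintype V] (G : SimpleGraph V) : ℕ :=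
  Finset.univ.sup fun S : Finset V => if IsIndep G S then S.card else 0

/-- `S` is a maximum independent set of `G`. -/
def IsMaxIndep {V : Type*} [Fintype V] (G : SimpleGraph V) (S : Finset V) : Prop :=
  IsIndep G S ∧ S.card = alpha G

/-- `S` is a maximal (inclusion-wise) independent set of `G`. -/
def IsMaximalIndep {V : Type*} [DecidableEq V] (G : SimpleGraph V) (S : Finset V) : Prop :=
  IsIndep G S ∧ ∀ x, x ∉ S → ¬ IsIndep G (insert x S)

/-- `G` is well-covered: every maximal independent set has cardinality `α(G)`. -/
def WellCovered {V : Type*} [Fintype V] [DecidableEq V] (G : SimpleGraph V) : Prop :=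
  ∀ S : Finset V, IsMaximalIndep G S → S.card = alpha G

/-- `G ∈ W_p`: `|V(G)| ≥ p` and every `p` pairwise disjoint independent sets extend to
`p` pairwise disjoint maximum independent sets. -/
def MemW {V : Type*} [Fintype V] (G : SimpleGraph V) (p : ℕ) : Prop :=
  p ≤ Fintype.card V ∧
    ∀ A : Fin p → Finset V, (∀ i, IsIndep G (A i)) →
      (∀ i j, i ≠ j → Disjoint (A i) (A j)) →
      ∃ M : Fin p → Finset V, (∀ i, IsMaxIndep G (M i)) ∧
        (∀ i j, i ≠ j → Disjoint (M i) (M j)) ∧ ∀ i, A i ⊆ M i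

/-- The `W`-index of `G`: the largest `p` with `G ∈ W_p`. -/
noncomputable def wIndex {V : Type*} [Fintype V] (G : SimpleGraph V) : ℕ :=
  sSup {p : ℕ | MemW G p}

/-- The fiber `F_G(S)`: the vertices `x ∉ S` with `S ∪ {x}` a maximum independent set. -/
noncomputable def fiber {V : Type*} [Fintype V] [DecidableEq V]
    (G : SimpleGraph V) (S : Finset V) : Finset V :=
  Finset.univ.filter fun x => x ∉ S ∧ IsMaxIndep G (insert x S)

/-- `G` is `α`-critical: deleting any edge increases the independence number. -/
def AlphaCritical {V : Type*} [Fintype V] (G : SimpleGraph V) : Prop :=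
  ∀ x y, G.Adj x y → alpha G < alpha (G.deleteEdges {s(x, y)})

/-- `H` is `K_t`-saturated: `H` is `K_t`-free but adding any missing edge creates a `K_t`. -/
def KSaturated {V : Type*} [Fintype V] (H : SimpleGraph V) (t : ℕ) : Prop :=
  (∀ Q : Finset V, ¬ H.IsNClique t Q) ∧
    ∀ x y : V, x ≠ y → ¬ H.Adj x y →
      ∃ Q : Finset V, (H ⊔ SimpleGraph.fromEdgeSet {s(x, y)}).IsNClique t Q

/-- `Q` is an inclusion-maximal clique of `H`. -/
def IsMaximalClique {V : Type*} [DecidableEq V] (H : SimpleGraph V) (Q : Finset V) : Prop :=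
  H.IsClique (Q : Set V) ∧ ∀ x, x ∉ Q → ¬ H.IsClique ((insert x Q : Finset V) : Set V)

/-- The `(r-1)`-clique-codegree of `Q` in `H`: the number of vertices extending `Q`
to an `r`-clique of `H`. -/
noncomputable def codeg {V : Type*} [Fintype V] [DecidableEq V]
    (H : SimpleGraph V) (r : ℕ) (Q : Finset V) : ℕ :=
  (Finset.univ.filter fun x => x ∉ Q ∧ H.IsNClique r (insert x Q)).card

/-- The minimum `(r-1)`-clique-codegree `δ^cl_{r-1}(H)`. -/
noncomputable def minCliqueCodeg {V : Type*} [Fintype V] [DecidableEq V]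
    (H : SimpleGraph V) (r : ℕ) : ℕ :=
  sInf {m : ℕ | ∃ Q : Finset V, H.IsNClique (r - 1) Q ∧ codeg H r Q = m}

/-- The vertex set of the localization `G_S = G - N_G[S]`. -/
noncomputable def localVerts {V : Type*} [Fintype V] (G : SimpleGraph V) (S : Finset V) :
    Finset V :=
  Finset.univ.filter fun v => v ∉ S ∧ ∀ s ∈ S, ¬ G.Adj s v

/-- The localization `G_S = G - N_G[S]`, as an induced subgraph. -/
noncomputable def localize {V : Type*} [Fintype V] (G : SimpleGraph V) (S : Finset V) :
    SimpleGraph {v : V // v ∈ localVerts G S} :=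
  SimpleGraph.comap (fun v => (v : V)) G

/-- The vertex set of the edge-localization `G_{ab} = G - (N_G(a) ∪ N_G(b))`. -/
noncomputable def edgeVerts {V : Type*} [Fintype V] (G : SimpleGraph V) (a b : V) : Finset V :=
  Finset.univ.filter fun v => ¬ G.Adj a v ∧ ¬ G.Adj b v

/-- The edge-localization `G_{ab} = G - (N_G(a) ∪ N_G(b))`, as an induced subgraph. -/
noncomputable def edgeLocalize {V : Type*} [Fintype V] (G : SimpleGraph V) (a b : V) :
    SimpleGraph {v : V // v ∈ edgeVerts G a b} :=
  SimpleGraph.comap (fun v => (v : V)) G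

/-- `G` is the disjoint union of `r` complete graphs, each of order at least `p`. -/
def DisjUnionCliques {V : Type*} (G : SimpleGraph V) (r p : ℕ) : Prop :=
  ∃ P : Fin r → Finset V, (∀ v, ∃! i, v ∈ P i) ∧ (∀ i, p ≤ (P i).card) ∧
    ∀ x y, G.Adj x y ↔ ∃ i, x ∈ P i ∧ y ∈ P i ∧ x ≠ y

lemma IsIndep.card_le_alpha {V : Type*} [Fintype V] {G : SimpleGraph V} {S : Finset V}
    (hS : IsIndep G S) : S.card ≤ alpha G := by
  have h := Finset.le_sup (f := fun S : Finset V => if IsIndep G S then S.card else 0)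
    (Finset.mem_univ S)
  simpa [alpha, hS] using h

lemma exists_isMaxIndep {V : Type*} [Fintype V] (G : SimpleGraph V) :
    ∃ S, IsMaxIndep G S := by
  obtain ⟨S, -, hS⟩ := Finset.exists_mem_eq_sup (univ : Finset (Finset V)) univ_nonempty
    fun S : Finset V => if IsIndep G S then S.card else 0
  by_cases h : IsIndep G S
  · exact ⟨S, h, by simpa [alpha, h] using hS.symm⟩
  · refine ⟨∅, fun x hx => by simp at hx, ?_⟩
    simpa [alpha, h] using hS.symm

lemma IsIndep.mono {V : Type*} {G : SimpleGraph V} {S T : Finset V} (hT : IsIndep G T)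
    (h : S ⊆ T) : IsIndep G S :=
  fun _ hx _ hy => hT (h hx) (h hy)

lemma isNClique_compl_iff {V : Type*} {G : SimpleGraph V} {S : Finset V} {k : ℕ} :
    Gᶜ.IsNClique k S ↔ IsIndep G S ∧ S.card = k := by
  simp only [SimpleGraph.isNClique_compl, SimpleGraph.isNIndepSet_iff, SimpleGraph.isIndepSet_iff,
    Set.Pairwise, mem_coe, IsIndep]

/-- In a `W_p` graph every independent set of size `α(G) - 1` has at least `p` extensions
to a maximum independent set. -/
lemma MemW.le_card_fiber {V : Type*} [Fintype V] [DecidableEq V] {G : SimpleGraph V} {p : ℕ}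
    (hW : MemW G p) {S : Finset V} (hS : IsIndep G S) (hc : S.card + 1 = alpha G) :
    p ≤ (fiber G S).card := by
  by_contra! hlt
  obtain ⟨q, rfl⟩ : ∃ q, p = q + 1 := ⟨p - 1, by lia⟩
  obtain ⟨f⟩ : Nonempty (fiber G S ↪ Fin q) :=
    Function.Embedding.nonempty_of_card_le (by simpa using Nat.lt_succ_iff.1 hlt)
  let B : Fin q → Finset V := fun i => (fiber G S).filter fun x => ∃ h, f ⟨x, h⟩ = i
  have hBS : ∀ i, Disjoint S (B i) := fun i => by
    rw [Finset.disjoint_right]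
    intro x hx
    exact (mem_filter.1 (mem_filter.1 hx).1).2.1
  obtain ⟨M, hM, hd, hA⟩ := hW.2 (Fin.cons S B)
    (by
      refine Fin.cases hS fun i x hx y hy hne => ?_
      obtain ⟨-, h₁, h₂⟩ := mem_filter.1 hx
      obtain ⟨-, h₃, h₄⟩ := mem_filter.1 hy
      exact absurd (congrArg Subtype.val (f.injective (h₂.trans h₄.symm))) hne)
    (by
      refine Fin.cases (Fin.cases (fun h => absurd rfl h) fun j _ => hBS j)
        fun i => Fin.cases (fun _ => (hBS i).symm) fun j hij => ?_
      simp only [Fin.cons_succ]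
      rw [Finset.disjoint_left]
      intro x hx hy
      obtain ⟨-, _, h₂⟩ := mem_filter.1 hx
      obtain ⟨-, _, h₄⟩ := mem_filter.1 hy
      exact hij (congrArg Fin.succ (h₂.symm.trans h₄)))
  have hS0 : S ⊆ M 0 := hA 0
  obtain ⟨x, hxS, hx⟩ := (Finset.exists_eq_insert_iff (s := S) (t := M 0)).2
    ⟨hS0, by rw [hc, (hM 0).2]⟩
  have hxF : x ∈ fiber G S := mem_filter.2 ⟨mem_univ _, hxS, hx ▸ hM 0⟩
  have hxB : x ∈ B (f ⟨x, hxF⟩) := mem_filter.2 ⟨hxF, hxF, rfl⟩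
  exact Finset.disjoint_left.1 (hd 0 _ (Fin.succ_ne_zero (f ⟨x, hxF⟩)).symm)
    (hx ▸ mem_insert_self x S) (hA (f ⟨x, hxF⟩).succ hxB)

lemma MemW.exists_isMaxIndep_mem {V : Type*} [Fintype V] {G : SimpleGraph V} {p : ℕ}
    (hW : MemW G p) (hp : 1 ≤ p) (v : V) : ∃ M, IsMaxIndep G M ∧ v ∈ M := by
  obtain ⟨q, rfl⟩ : ∃ q, p = q + 1 := ⟨p - 1, by lia⟩
  obtain ⟨M, hM, -, hA⟩ := hW.2 (Fin.cons {v} fun _ => ∅)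
    (Fin.cases (fun x hx y hy hne => by simp_all) fun i x hx => by simp at hx)
    (Fin.cases (Fin.cases (fun h => absurd rfl h) fun j _ => by simp) fun i j _ => by simp)
  exact ⟨M 0, hM 0, hA 0 (mem_singleton_self v)⟩

lemma MemW.le_card_fiber_erase {V : Type*} [Fintype V] [DecidableEq V] {G : SimpleGraph V} {p : ℕ}
    (hW : MemW G p) {M : Finset V} (hM : IsMaxIndep G M) {m : V} (hm : m ∈ M) :
    p ≤ (fiber G (M.erase m)).card :=
  hW.le_card_fiber (hM.1.mono (erase_subset _ _)) (by rw [card_erase_add_one hm, hM.2])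

lemma IsMaxIndep.disjoint_fiber_erase {V : Type*} [Fintype V] [DecidableEq V] {G : SimpleGraph V}
    {M : Finset V} (hM : IsMaxIndep G M) {a b : V} (hab : a ≠ b) :
    Disjoint (fiber G (M.erase a)) (fiber G (M.erase b)) := by
  rw [Finset.disjoint_left]
  intro x hxa hxb
  obtain ⟨-, hxa, hia, -⟩ := mem_filter.1 hxa
  obtain ⟨-, hxb, hib, -⟩ := mem_filter.1 hxb
  by_cases hx : x ∈ M
  · simp only [mem_erase, hx, and_true, not_not] at hxa hxb
    exact hab (hxa.symm.trans hxb)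
  · have hadj : ∀ y ∈ M, ¬ G.Adj x y := fun y hy => by
      have hxy : x ≠ y := fun h => hx (h ▸ hy)
      by_cases hya : y = a
      · exact hib (mem_insert_self _ _)
          (mem_insert_of_mem (mem_erase.2 ⟨fun h => hab (hya.symm.trans h), hy⟩)) hxy
      · exact hia (mem_insert_self _ _) (mem_insert_of_mem (mem_erase.2 ⟨hya, hy⟩)) hxy
    have hind : IsIndep G (insert x M) := fun u hu w hw hne => by
      rcases mem_insert.1 hu with rfl | huM <;> rcases mem_insert.1 hw with rfl | hwM
      · exact absurd rfl hne
      · exact hadj _ hwM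
      · exact fun h => hadj _ huM h.symm
      · exact hM.1 huM hwM hne
    have := hind.card_le_alpha
    rw [card_insert_of_notMem hx, hM.2] at this
    lia

/-- In a `W_p` graph every vertex has at least `p (α(G) - 1)` non-neighbours. -/
lemma MemW.mul_le_degree_compl {V : Type*} [Fintype V] [DecidableEq V] {G : SimpleGraph V} {p : ℕ}
    (hW : MemW G p) (hp : 1 ≤ p) (v : V) : p * (alpha G - 1) ≤ Gᶜ.degree v := by
  obtain ⟨M, hM, hv⟩ := hW.exists_isMaxIndep_mem hp v
  calc p * (alpha G - 1) = ∑ m ∈ M.erase v, p := by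
        rw [sum_const, card_erase_of_mem hv, hM.2, smul_eq_mul, mul_comm]
    _ ≤ ∑ m ∈ M.erase v, (fiber G (M.erase m)).card :=
        sum_le_sum fun m hm => hW.le_card_fiber_erase hM (mem_of_mem_erase hm)
    _ = ((M.erase v).biUnion fun m => fiber G (M.erase m)).card :=
        (card_biUnion fun a _ b _ hab => hM.disjoint_fiber_erase hab).symm
    _ ≤ Gᶜ.degree v := by
        rw [← SimpleGraph.card_neighborFinset_eq_degree]
        refine card_le_card fun x hx => ?_
        obtain ⟨m, hm, hx⟩ := mem_biUnion.1 hx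
        obtain ⟨-, hxm, hi, -⟩ := mem_filter.1 hx
        have hvm : v ∈ M.erase m := mem_erase.2 ⟨(ne_of_mem_erase hm).symm, hv⟩
        have hne : v ≠ x := fun h => hxm (h ▸ hvm)
        rw [SimpleGraph.mem_neighborFinset, SimpleGraph.compl_adj]
        exact ⟨hne, hi (mem_insert_of_mem hvm) (mem_insert_self _ _) hne⟩

lemma IsMaxIndep.bijOn_coloring {V : Type*} [Fintype V] {G : SimpleGraph V} {r : ℕ}
    (halpha : alpha G = r) (C : Gᶜ.Coloring (Fin r)) {M : Finset V} (hM : IsMaxIndep G M) :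
    Set.InjOn C M ∧ ∀ i, ∃ m ∈ M, C m = i := by
  have hinj : Set.InjOn C M := fun a ha b hb hab => by
    by_contra hne
    exact C.valid ((SimpleGraph.compl_adj ..).2 ⟨hne, hM.1 ha hb hne⟩) hab
  refine ⟨hinj, fun i => ?_⟩
  have : M.image C = univ := by
    rw [← card_eq_iff_eq_univ, card_image_of_injOn hinj, hM.2, halpha, Fintype.card_fin]
  simpa using this.symm.subset (mem_univ i)

/-- If the complement of an `α`-critical graph is `α(G)`-colourable, its colour classes are
the parts of a complete multipartite graph. -/
lemma AlphaCritical.adj_iff_of_coloring {V : Type*} [Fintype V] {G : SimpleGraph V} {r : ℕ}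
    (hcrit : AlphaCritical G) (halpha : alpha G = r) (C : Gᶜ.Coloring (Fin r)) (x y : V) :
    G.Adj x y ↔ C x = C y ∧ x ≠ y := by
  refine ⟨fun h => ⟨?_, h.ne⟩, fun ⟨hC, hne⟩ => ?_⟩
  · by_contra hC
    obtain ⟨S, hS, hc⟩ := exists_isMaxIndep (G.deleteEdges {s(x, y)})
    have hlt := hcrit x y h
    rw [← hc, halpha] at hlt
    obtain ⟨u, hu, w, hw, hne, huw⟩ := Finset.exists_ne_map_eq_of_card_lt_of_maps_to
      (t := (univ : Finset (Fin r))) (by simpa using hlt) (f := C) (fun _ _ => by simp)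
    have hadj : G.Adj u w := by
      by_contra hn
      exact C.valid ((SimpleGraph.compl_adj ..).2 ⟨hne, hn⟩) huw
    refine hS hu hw hne (SimpleGraph.deleteEdges_adj.2 ⟨hadj, fun he => ?_⟩)
    rcases Sym2.eq_iff.1 (Set.mem_singleton_iff.1 he) with ⟨rfl, rfl⟩ | ⟨rfl, rfl⟩
    · exact hC huw
    · exact hC huw.symm
  · by_contra hn
    exact C.valid ((SimpleGraph.compl_adj ..).2 ⟨hne, hn⟩) hC

lemma MemW.disjUnionCliques_of_coloring {V : Type*} [Fintype V] [DecidableEq V] {G : SimpleGraph V}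
    {p r : ℕ} (hW : MemW G p) (hcrit : AlphaCritical G) (halpha : alpha G = r)
    (C : Gᶜ.Coloring (Fin r)) : DisjUnionCliques G r p := by
  refine ⟨fun i => univ.filter fun v => C v = i, fun v => ⟨C v, by simp, by simp⟩, fun i => ?_,
    fun x y => ?_⟩
  · obtain ⟨M, hM⟩ := exists_isMaxIndep G
    obtain ⟨m, hm, rfl⟩ := (hM.bijOn_coloring halpha C).2 i
    refine (hW.le_card_fiber_erase hM hm).trans (card_le_card fun x hx => ?_)
    obtain ⟨-, hxm, hx⟩ := mem_filter.1 hx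
    obtain ⟨y, hy, hyx⟩ := (hx.bijOn_coloring halpha C).2 (C m)
    rcases mem_insert.1 hy with rfl | hy
    · simpa using hyx
    · exact absurd ((hM.bijOn_coloring halpha C).1 (mem_of_mem_erase hy) hm hyx)
        (ne_of_mem_erase hy)
  · rw [hcrit.adj_iff_of_coloring halpha C]
    simp [eq_comm]

/-- Small-order rigidity. -/
theorem small_order_rigidity {V : Type*} [Fintype V] [DecidableEq V]
    (G : SimpleGraph V) (p r : ℕ) (hp : 1 ≤ p)
    (hcrit : AlphaCritical G) (hW : MemW G p) (hr : 2 ≤ r) (halpha : alpha G = r)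
    (hn : (Fintype.card V : ℚ)
      < (p : ℚ) * (3 * (r : ℚ) - 1) * ((r : ℚ) - 1) / (3 * (r : ℚ) - 4)) :
    DisjUnionCliques G r p := by
  have hfree : Gᶜ.CliqueFree (r + 1) := fun S hS => by
    obtain ⟨hi, hc⟩ := isNClique_compl_iff.1 hS
    have := hi.card_le_alpha
    lia
  obtain ⟨M, hM⟩ := exists_isMaxIndep G
  obtain ⟨v, -⟩ : M.Nonempty := card_pos.1 (by rw [hM.2]; lia)
  have : Nonempty V := ⟨v⟩
  have hmin : p * (r - 1) ≤ Gᶜ.minDegree :=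
    SimpleGraph.le_minDegree_of_forall_le_degree _ _ fun v =>
      halpha ▸ hW.mul_le_degree_compl hp v
  have hdeg : (3 * r - 4) * Fintype.card V / (3 * r - 1) < Gᶜ.minDegree := by
    refine lt_of_lt_of_le ?_ hmin
    obtain ⟨s, rfl⟩ : ∃ s, r = s + 2 := ⟨r - 2, by lia⟩
    have hpos : (0 : ℚ) < 3 * ((s + 2 : ℕ) : ℚ) - 4 := by
      push_cast
      linarith [Nat.cast_nonneg (α := ℚ) s]
    rw [lt_div_iff₀ hpos] at hn
    rw [Nat.div_lt_iff_lt_mul (by lia), show 3 * (s + 2) - 4 = 3 * s + 2 by lia,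
      show 3 * (s + 2) - 1 = 3 * s + 5 by lia, show s + 2 - 1 = s + 1 by lia]
    have : ((3 * s + 2 : ℕ) : ℚ) * Fintype.card V < p * (s + 1 : ℕ) * (3 * s + 5 : ℕ) := by
      push_cast at hn ⊢
      linarith
    exact_mod_cast this
  obtain ⟨C⟩ := SimpleGraph.colorable_of_cliqueFree_lt_minDegree hfree hdeg
  exact hW.disjUnionCliques_of_coloring hcrit halpha C
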